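/- arXiv:1503.00694 — 4 statements merged into one kernel-verified Lean document; each statement's English description precedes it below -/
import Mathlib

section
/- Every PSCF that satisfies composition-consistency is neutral: for all agendas A, B, every bijection π : A → B, and every profile R on A, π(f(R)) = f(π(R)). -/
open Finset

namespace PSC

/-- `r` is a linear order (complete, transitive, antisymmetric; as a set of pairs) on `A`. -/
def IsLinearOrderOn (A : Finset ℕ) (r : Finset (ℕ × ℕ)) : Prop :=
  r ⊆ A ×ˢ A ∧ (∀ x ∈ A, (x, x) ∈ r) ∧
    (∀ x ∈ A, ∀ y ∈ A, (x, y) ∈ r ∨ (y, x) ∈ r) ∧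
    (∀ x y z : ℕ, (x, y) ∈ r → (y, z) ∈ r → (x, z) ∈ r) ∧
    (∀ x y : ℕ, (x, y) ∈ r → (y, x) ∈ r → x = y)

open Classical in
/-- The set `L(A)` of linear orders on the agenda `A`. -/
noncomputable def linOrders (A : Finset ℕ) : Finset (Finset (ℕ × ℕ)) :=
  (A ×ˢ A).powerset.filter (fun r => IsLinearOrderOn A r)

/-- `R` is a (fractional) preference profile on the agenda `A`. -/
def IsProfile (A : Finset ℕ) (R : Finset (ℕ × ℕ) → ℚ) : Prop :=
  (∀ r, r ∉ linOrders A → R r = 0) ∧ (∀ r, 0 ≤ R r) ∧ (∑ r ∈ linOrders A, R r) = 1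

open Classical in
/-- `R(x,y)`: the total weight of orders ranking `x` strictly above `y`. -/
noncomputable def pref (A : Finset ℕ) (R : Finset (ℕ × ℕ) → ℚ) (x y : ℕ) : ℚ :=
  ∑ r ∈ (linOrders A).filter (fun r => (x, y) ∈ r ∧ (y, x) ∉ r), R r

/-- The majority margin `M_R(x,y) = R(x,y) - R(y,x)`. -/
noncomputable def margin (A : Finset ℕ) (R : Finset (ℕ × ℕ) → ℚ) (x y : ℕ) : ℚ :=
  pref A R x y - pref A R y x

/-- `p` is a lottery on `A`. -/
def IsLottery (A : Finset ℕ) (p : ℕ → ℚ) : Prop :=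
  (∀ x, x ∉ A → p x = 0) ∧ (∀ x, 0 ≤ p x) ∧ (∑ x ∈ A, p x) = 1

/-- `Δ(A)`, the set of lotteries on `A`. -/
def lotteries (A : Finset ℕ) : Set (ℕ → ℚ) := {p | IsLottery A p}

/-- 1-norm distance between two profiles on `A`. -/
noncomputable def profileDist (A : Finset ℕ) (R R' : Finset (ℕ × ℕ) → ℚ) : ℚ :=
  ∑ r ∈ linOrders A, |R r - R' r|

/-- 1-norm distance between two lotteries on `A`. -/
noncomputable def lotteryDist (A : Finset ℕ) (p q : ℕ → ℚ) : ℚ :=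
  ∑ x ∈ A, |p x - q x|

/-- Restriction of an order to `B`. -/
def restrictOrder (B : Finset ℕ) (r : Finset (ℕ × ℕ)) : Finset (ℕ × ℕ) := r ∩ B ×ˢ B

open Classical in
/-- The restriction `R|_B` of a profile on `A` to `B`. -/
noncomputable def restrictProfile (A B : Finset ℕ) (R : Finset (ℕ × ℕ) → ℚ) :
    Finset (ℕ × ℕ) → ℚ :=
  fun s => ∑ r ∈ (linOrders A).filter (fun r => restrictOrder B r = s), R r

/-- `B` is a component in the profile `R` on `A`. -/
def IsComponent (A B : Finset ℕ) (R : Finset (ℕ × ℕ) → ℚ) : Prop :=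
  B ⊆ A ∧ ∀ a ∈ A \ B, ∀ b ∈ B, ∀ b' ∈ B, ∀ r ∈ linOrders A, 0 < R r →
    ((a, b) ∈ r ↔ (a, b') ∈ r)

/-- The composed lottery `p ×_b q` (where `B` is the component). -/
def compLottery (B : Finset ℕ) (b : ℕ) (p q : ℕ → ℚ) : ℕ → ℚ :=
  fun x => if x ∈ B then p b * q x else p x

/-- `X ×_b Y` for sets of lotteries. -/
def compSet (B : Finset ℕ) (b : ℕ) (X Y : Set (ℕ → ℚ)) : Set (ℕ → ℚ) :=
  {pr | ∃ p ∈ X, ∃ q ∈ Y, pr = compLottery B b p q}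

/-- A probabilistic social choice function: to every (finite nonempty) agenda `A ⊆ ℕ` and
every profile on `A` it assigns a nonempty convex set of lotteries on `A`; it is upper
hemi-continuous and satisfies unanimity and decisiveness. -/
structure PSCF where
  choice : Finset ℕ → (Finset (ℕ × ℕ) → ℚ) → Set (ℕ → ℚ)
  nonempty : ∀ A : Finset ℕ, A.Nonempty → ∀ R, IsProfile A R → (choice A R).Nonempty
  subset_lotteries : ∀ A : Finset ℕ, A.Nonempty → ∀ R, IsProfile A R →
    choice A R ⊆ lotteries A
  convex : ∀ A : Finset ℕ, A.Nonempty → ∀ R, IsProfile A R →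
    ∀ p ∈ choice A R, ∀ q ∈ choice A R, ∀ t : ℚ, 0 ≤ t → t ≤ 1 →
      (fun x => t * p x + (1 - t) * q x) ∈ choice A R
  continuity : ∀ A : Finset ℕ, A.Nonempty → ∀ R, IsProfile A R → ∀ ε : ℚ, 0 < ε →
    ∃ δ : ℚ, 0 < δ ∧ ∀ R', IsProfile A R' → profileDist A R R' < δ →
      ∀ p ∈ choice A R', ∃ q ∈ choice A R, lotteryDist A p q < ε
  unanimity : ∀ x y : ℕ, ∀ R, IsProfile {x, y} R → pref {x, y} R x y = 1 →
    choice {x, y} R = {fun z => if z = x then 1 else 0}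
  decisive : ∀ A : Finset ℕ, A.Nonempty → ∀ R, IsProfile A R → ∀ ε : ℚ, 0 < ε →
    ∃ R', IsProfile A R' ∧ profileDist A R R' < ε ∧ ∃ p, choice A R' = {p}

/-- Population-consistency. -/
def PopulationConsistent (f : PSCF) : Prop :=
  ∀ A : Finset ℕ, A.Nonempty → ∀ R' R'', IsProfile A R' → IsProfile A R'' →
    ∀ l : ℚ, 0 ≤ l → l ≤ 1 →
      f.choice A R' ∩ f.choice A R'' ⊆ f.choice A (fun r => l * R' r + (1 - l) * R'' r)

/-- Composition-consistency. -/
def CompositionConsistent (f : PSCF) : Prop :=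
  ∀ A' B : Finset ℕ, ∀ b : ℕ, A' ∩ B = {b} →
    ∀ R, IsProfile (A' ∪ B) R → IsComponent (A' ∪ B) B R →
      f.choice (A' ∪ B) R =
        compSet B b (f.choice A' (restrictProfile (A' ∪ B) A' R))
          (f.choice B (restrictProfile (A' ∪ B) B R))

/-- The maximal-lotteries correspondence. -/
noncomputable def ML (A : Finset ℕ) (R : Finset (ℕ × ℕ) → ℚ) : Set (ℕ → ℚ) :=
  {p | IsLottery A p ∧ ∀ q, IsLottery A q →
    0 ≤ ∑ x ∈ A, ∑ y ∈ A, p x * margin A R x y * q y}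

/-- The uniform profile `uni(L(A))` on `A`. -/
noncomputable def uniProfile (A : Finset ℕ) : Finset (ℕ × ℕ) → ℚ :=
  fun r => if r ∈ linOrders A then ((Nat.factorial A.card : ℕ) : ℚ)⁻¹ else 0

/-- The uniform lottery `uni(A)` on `A`. -/
def uniLottery (A : Finset ℕ) : ℕ → ℚ :=
  fun x => if x ∈ A then (A.card : ℚ)⁻¹ else 0

/-- The degenerate lottery on `x`. -/
def degLottery (x : ℕ) : ℕ → ℚ := fun z => if z = x then 1 else 0

/-- `x` is a (weak) Condorcet winner in `R`. -/
def IsCondorcetWinner (A : Finset ℕ) (R : Finset (ℕ × ℕ) → ℚ) (x : ℕ) : Prop :=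
  x ∈ A ∧ ∀ y ∈ A, 0 ≤ margin A R x y

/-- `R` is regular on `A'`. -/
def Regular (A A' : Finset ℕ) (R : Finset (ℕ × ℕ) → ℚ) : Prop :=
  ∀ x ∈ A', (∑ y ∈ A', margin A R x y) = 0

/-- `R` is strongly regular on `A'`. -/
def StronglyRegular (A A' : Finset ℕ) (R : Finset (ℕ × ℕ) → ℚ) : Prop :=
  ∀ x ∈ A', ∀ y ∈ A', margin A R x y = 0

/-- Image of an order under a renaming `π`. -/
def mapOrder (π : ℕ → ℕ) (r : Finset (ℕ × ℕ)) : Finset (ℕ × ℕ) :=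
  r.image (fun xy => (π xy.1, π xy.2))

open Classical in
/-- The image `π(R)` of a profile on `A` under a renaming `π`. -/
noncomputable def mapProfile (π : ℕ → ℕ) (A : Finset ℕ) (R : Finset (ℕ × ℕ) → ℚ) :
    Finset (ℕ × ℕ) → ℚ :=
  fun s => ∑ r ∈ (linOrders A).filter (fun r => mapOrder π r = s), R r

open Classical in
/-- The image `π(p)` of a lottery on `A` under a renaming `π`. -/
noncomputable def mapLottery (π : ℕ → ℕ) (A : Finset ℕ) (p : ℕ → ℚ) : ℕ → ℚ :=
  fun y => ∑ x ∈ A.filter (fun x => π x = y), p x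

/-- The bound `ε_n = (4^n · ∏_{k=1}^n k!)⁻¹`. -/
noncomputable def epsN (n : ℕ) : ℚ :=
  (((4 ^ n * ∏ k ∈ Finset.Icc 1 n, Nat.factorial k : ℕ) : ℚ))⁻¹

theorem mem_linOrders {A : Finset ℕ} {r : Finset (ℕ × ℕ)} :
    r ∈ linOrders A ↔ IsLinearOrderOn A r := by
  classical
  unfold linOrders
  rw [Finset.mem_filter, Finset.mem_powerset]
  exact ⟨fun h => h.2, fun h => ⟨h.1, h⟩⟩

open Classical in
noncomputable def push {α β : Type} (S : Finset α) (g : α → β) (R : α → ℚ) : β → ℚ :=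
  fun s => ∑ r ∈ S.filter (fun r => g r = s), R r

theorem push_push {α β γ : Type} (S : Finset α) (T : Finset β) (g : α → β) (h : β → γ)
    (R : α → ℚ) (hg : ∀ r ∈ S, g r ∈ T) :
    push T h (push S g R) = push S (fun r => h (g r)) R := by
  classical
  funext s
  unfold push
  rw [← Finset.sum_fiberwise_of_maps_to (s := S.filter (fun r => h (g r) = s))
    (t := T.filter (fun r => h r = s)) (g := g)]
  · apply Finset.sum_congr rfl
    intro x hx
    apply Finset.sum_congr _ (fun _ _ => rfl)
    ext r
    simp only [Finset.mem_filter] at hx ⊢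
    constructor
    · rintro ⟨h1, rfl⟩; exact ⟨⟨h1, hx.2⟩, rfl⟩
    · rintro ⟨⟨h1, _⟩, h2⟩; exact ⟨h1, h2⟩
  · intro r hr
    simp only [Finset.mem_filter] at hr ⊢
    exact ⟨hg r hr.1, hr.2⟩

theorem push_congr {α β : Type} (S : Finset α) (g h : α → β) (R : α → ℚ)
    (hg : ∀ r ∈ S, g r = h r) : push S g R = push S h R := by
  classical
  funext s
  unfold push
  rw [Finset.filter_congr (fun r hr => by rw [hg r hr])]

theorem push_id {α : Type} (S : Finset α) (R : α → ℚ) (h : ∀ r, r ∉ S → R r = 0) :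
    push S (fun r => r) R = R := by
  classical
  funext s
  unfold push
  have e : S.filter (fun r => (fun r => r) r = s) = if s ∈ S then {s} else ∅ := by
    ext r
    split_ifs with hs <;> simp <;> grind
  rw [e]
  split_ifs with hs
  · simp
  · simp [h s hs]

theorem push_pos {α β : Type} (S : Finset α) (g : α → β) (R : α → ℚ) (s : β)
    (h : push S g R s ≠ 0) : ∃ r ∈ S, g r = s := by
  classical
  unfold push at h
  obtain ⟨r, hr, _⟩ := Finset.exists_ne_zero_of_sum_ne_zero h
  exact ⟨r, (Finset.mem_filter.1 hr).1, (Finset.mem_filter.1 hr).2⟩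

theorem push_profile {A B : Finset ℕ} {R : Finset (ℕ × ℕ) → ℚ} (hR : IsProfile A R)
    (g : Finset (ℕ × ℕ) → Finset (ℕ × ℕ)) (hg : ∀ r ∈ linOrders A, g r ∈ linOrders B) :
    IsProfile B (push (linOrders A) g R) := by
  classical
  refine ⟨?_, ?_, ?_⟩
  · intro s hs
    by_contra h
    obtain ⟨r, hr, rfl⟩ := push_pos _ _ _ _ h
    exact hs (hg r hr)
  · intro s
    exact Finset.sum_nonneg (fun r _ => hR.2.1 r)
  · rw [← hR.2.2]
    unfold push
    rw [← Finset.sum_fiberwise_of_maps_to hg R]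
    apply Finset.sum_congr rfl
    intro s _
    apply Finset.sum_congr _ (fun _ _ => rfl)
    ext r; simp

theorem mapProfile_eq (π : ℕ → ℕ) (A : Finset ℕ) (R : Finset (ℕ × ℕ) → ℚ) :
    mapProfile π A R = push (linOrders A) (mapOrder π) R := by
  funext s
  unfold mapProfile push
  apply Finset.sum_congr _ (fun _ _ => rfl)
  ext r; simp

theorem restrictProfile_eq (A B : Finset ℕ) (R : Finset (ℕ × ℕ) → ℚ) :
    restrictProfile A B R = push (linOrders A) (restrictOrder B) R := by
  funext s
  unfold restrictProfile push
  apply Finset.sum_congr _ (fun _ _ => rfl)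
  ext r; simp

theorem mapLottery_eq (π : ℕ → ℕ) (A : Finset ℕ) (p : ℕ → ℚ) :
    mapLottery π A p = push A π p := by
  funext s
  unfold mapLottery push
  apply Finset.sum_congr _ (fun _ _ => rfl)
  ext r; simp

theorem mem_mapOrder (σ : Equiv.Perm ℕ) (r : Finset (ℕ × ℕ)) (x y : ℕ) :
    (x, y) ∈ mapOrder σ r ↔ (σ.symm x, σ.symm y) ∈ r := by
  unfold mapOrder
  simp only [Finset.mem_image, Prod.mk.injEq, Prod.exists]
  constructor
  · rintro ⟨u, v, h, rfl, rfl⟩; simpa using h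
  · intro h; exact ⟨_, _, h, by simp, by simp⟩

theorem mem_image_perm (σ : Equiv.Perm ℕ) (A : Finset ℕ) (x : ℕ) :
    x ∈ A.image σ ↔ σ.symm x ∈ A := by
  simp only [Finset.mem_image]
  constructor
  · rintro ⟨u, h, rfl⟩; simpa using h
  · intro h; exact ⟨_, h, by simp⟩

theorem mapOrder_mem (σ : Equiv.Perm ℕ) {A : Finset ℕ} {r : Finset (ℕ × ℕ)}
    (hr : r ∈ linOrders A) : mapOrder σ r ∈ linOrders (A.image σ) := by
  rw [mem_linOrders] at hr ⊢
  obtain ⟨h1, h2, h3, h4, h5⟩ := hr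
  refine ⟨?_, ?_, ?_, ?_, ?_⟩
  · rintro ⟨x, y⟩ h
    rw [mem_mapOrder] at h
    have := h1 h
    rw [Finset.mem_product] at this ⊢
    simpa only [mem_image_perm] using this
  · intro x hx; rw [mem_mapOrder]; exact h2 _ ((mem_image_perm _ _ _).1 hx)
  · intro x hx y hy; simp only [mem_mapOrder]
    exact h3 _ ((mem_image_perm _ _ _).1 hx) _ ((mem_image_perm _ _ _).1 hy)
  · intro x y z; simp only [mem_mapOrder]; exact h4 _ _ _
  · intro x y; simp only [mem_mapOrder]
    intro h h'; exact σ.symm.injective (h5 _ _ h h')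

/-- Neutrality with respect to a permutation of the universe. -/
def Neut (f : PSCF) (σ : Equiv.Perm ℕ) (A : Finset ℕ) : Prop :=
  ∀ R, IsProfile A R →
    f.choice (A.image σ) (mapProfile σ A R) = mapLottery σ A '' f.choice A R

theorem Neut.mul {f : PSCF} {σ τ : Equiv.Perm ℕ} {A : Finset ℕ}
    (h1 : Neut f τ A) (h2 : Neut f σ (A.image τ)) : Neut f (σ * τ) A := by
  intro R hR
  have e := h2 (mapProfile τ A R) (mapProfile_eq τ A R ▸ push_profile hR _ (fun r hr => mapOrder_mem τ hr))
  rw [h1 R hR, Finset.image_image] at e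
  have e1 : mapProfile σ (A.image τ) (mapProfile τ A R) = mapProfile (⇑(σ * τ)) A R := by
    simp only [mapProfile_eq]
    rw [push_push _ _ _ _ _ (fun r hr => mapOrder_mem τ hr)]
    apply push_congr
    intro r _
    unfold mapOrder
    rw [Finset.image_image]; rfl
  have e2 : ∀ p, mapLottery σ (A.image τ) (mapLottery τ A p) = mapLottery (⇑(σ * τ)) A p := by
    intro p
    simp only [mapLottery_eq]
    rw [push_push _ _ _ _ _ (fun r hr => Finset.mem_image_of_mem _ hr)]
    rfl
  rw [e1, Set.image_image] at e
  simp only [e2] at e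
  exact e

theorem Neut.congr_one {f : PSCF} {σ : Equiv.Perm ℕ} {A : Finset ℕ} (hA : A.Nonempty)
    (h : ∀ x ∈ A, σ x = x) : Neut f σ A := by
  intro R hR
  have e0 : A.image σ = A := by
    rw [Finset.image_congr (g := fun x => x) (fun x hx => h x hx)]; simp
  have e1 : mapProfile σ A R = R := by
    rw [mapProfile_eq, push_congr _ _ (fun r => r), push_id _ _ hR.1]
    intro r hr
    rw [mem_linOrders] at hr
    unfold mapOrder
    rw [Finset.image_congr (g := fun x => x)]
    · simp
    · rintro ⟨x, y⟩ hx
      have := Finset.mem_product.1 (hr.1 hx)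
      simp [h x this.1, h y this.2]
  have e2 : ∀ p ∈ f.choice A R, mapLottery σ A p = p := by
    intro p hp
    have := f.subset_lotteries A hA R hR hp
    rw [mapLottery_eq, push_congr _ _ (fun r => r) _ h, push_id _ _ this.1]
  rw [e0, e1, Set.image_congr e2]; simp

def dup (A : Finset ℕ) (a b : ℕ) (r : Finset (ℕ × ℕ)) : Finset (ℕ × ℕ) :=
  ((insert b A) ×ˢ (insert b A)).filter (fun p =>
    ((if p.1 = b then a else p.1), (if p.2 = b then a else p.2)) ∈ r ∧ ¬ (p.1 = b ∧ p.2 = a))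

theorem mem_dup (A : Finset ℕ) (a b : ℕ) (r : Finset (ℕ × ℕ)) (x y : ℕ) :
    (x, y) ∈ dup A a b r ↔ (x ∈ insert b A ∧ y ∈ insert b A) ∧
      ((if x = b then a else x), (if y = b then a else y)) ∈ r ∧ ¬ (x = b ∧ y = a) := by
  unfold dup
  rw [Finset.mem_filter, Finset.mem_product]

theorem dup_mem {A : Finset ℕ} {a b : ℕ} (ha : a ∈ A) (hb : b ∉ A) {r : Finset (ℕ × ℕ)}
    (hr : r ∈ linOrders A) : dup A a b r ∈ linOrders (insert b A) := by
  rw [mem_linOrders] at hr ⊢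
  obtain ⟨h1, h2, h3, h4, h5⟩ := hr
  have hab : a ≠ b := fun h => hb (h ▸ ha)
  refine ⟨Finset.filter_subset _ _, ?_, ?_, ?_, ?_⟩
  · intro x hx
    rw [mem_dup]
    refine ⟨⟨hx, hx⟩, h2 _ ?_, ?_⟩
    · split_ifs with h
      · exact ha
      · exact (Finset.mem_insert.1 hx).resolve_left h
    · rintro ⟨rfl, h⟩; exact hab h.symm
  · intro x hx y hy
    simp only [mem_dup]
    have hx' : (if x = b then a else x) ∈ A := by
      split_ifs with h
      · exact ha
      · exact (Finset.mem_insert.1 hx).resolve_left h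
    have hy' : (if y = b then a else y) ∈ A := by
      split_ifs with h
      · exact ha
      · exact (Finset.mem_insert.1 hy).resolve_left h
    have h := h3 _ hx' _ hy'
    have haa := h2 a ha
    grind
  · intro x y z
    simp only [mem_dup]
    rintro ⟨⟨hx, hy⟩, hxy, n1⟩ ⟨⟨_, hz⟩, hyz, n2⟩
    refine ⟨⟨hx, hz⟩, h4 _ _ _ hxy hyz, ?_⟩
    rintro ⟨rfl, rfl⟩
    have := h5 (if x = x then z else x) (if y = x then z else y) hxy (by simpa [hab] using hyz)
    grind
  · intro x y
    simp only [mem_dup]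
    rintro ⟨⟨hx, hy⟩, hxy, n1⟩ ⟨_, hyx, n2⟩
    have := h5 _ _ hxy hyx
    grind

theorem restrict_mem {A B : Finset ℕ} (hBA : B ⊆ A) {r : Finset (ℕ × ℕ)}
    (hr : r ∈ linOrders A) : restrictOrder B r ∈ linOrders B := by
  rw [mem_linOrders] at hr ⊢
  obtain ⟨h1, h2, h3, h4, h5⟩ := hr
  unfold restrictOrder
  refine ⟨Finset.inter_subset_right, ?_, ?_, ?_, ?_⟩
  · intro x hx
    simp [hx, h2 x (hBA hx)]
  · intro x hx y hy
    simpa [hx, hy] using h3 x (hBA hx) y (hBA hy)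
  · intro x y z
    simp only [Finset.mem_inter, Finset.mem_product]
    rintro ⟨h, h'⟩ ⟨k, k'⟩
    exact ⟨h4 _ _ _ h k, h'.1, k'.2⟩
  · intro x y
    simp only [Finset.mem_inter]
    intro h k
    exact h5 _ _ h.1 k.1

theorem restrict_dup_self {A : Finset ℕ} {a b : ℕ} (hb : b ∉ A) {r : Finset (ℕ × ℕ)}
    (hr : r ∈ linOrders A) : restrictOrder A (dup A a b r) = r := by
  rw [mem_linOrders] at hr
  ext ⟨x, y⟩
  unfold restrictOrder
  rw [Finset.mem_inter, mem_dup, Finset.mem_product]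
  have h1 := @hr.1 (x, y)
  rw [Finset.mem_product] at h1
  grind

theorem restrict_dup_swap {A : Finset ℕ} {a b : ℕ} (ha : a ∈ A) (hb : b ∉ A)
    {r : Finset (ℕ × ℕ)} (hr : r ∈ linOrders A) :
    restrictOrder (A.image (Equiv.swap a b)) (dup A a b r) = mapOrder (Equiv.swap a b) r := by
  rw [mem_linOrders] at hr
  ext ⟨x, y⟩
  unfold restrictOrder
  rw [Finset.mem_inter, mem_dup, Finset.mem_product, mem_mapOrder]
  simp only [mem_image_perm, Equiv.symm_swap]
  have h1 := @hr.1 (Equiv.swap a b x, Equiv.swap a b y)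
  rw [Finset.mem_product] at h1
  simp only [Equiv.swap_apply_def] at h1 ⊢
  grind

theorem neut_single {f : PSCF} (hf : CompositionConsistent f) {A : Finset ℕ} {a b : ℕ}
    (ha : a ∈ A) (hb : b ∉ A) : Neut f (Equiv.swap a b) A := by
  classical
  intro R hR
  have hab : a ≠ b := fun h => hb (h ▸ ha)
  set σ := Equiv.swap a b with hσ
  have hAn : A.Nonempty := ⟨a, ha⟩
  have hU1 : A ∪ {a, b} = insert b A := by ext x; simp; grind
  have hU2 : A.image σ ∪ {a, b} = insert b A := by
    ext x
    rw [Finset.mem_union, mem_image_perm]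
    simp only [hσ, Equiv.symm_swap, Equiv.swap_apply_def, Finset.mem_insert,
      Finset.mem_singleton]
    grind
  have hI1 : A ∩ {a, b} = {a} := by ext x; simp; grind
  have hI2 : A.image σ ∩ {a, b} = {b} := by
    ext x
    rw [Finset.mem_inter, mem_image_perm]
    simp only [hσ, Equiv.symm_swap, Equiv.swap_apply_def, Finset.mem_insert,
      Finset.mem_singleton]
    grind
  set Q := push (linOrders A) (dup A a b) R with hQ
  have hQp : IsProfile (insert b A) Q := push_profile hR _ (fun r hr => dup_mem ha hb hr)
  have hC : IsComponent (insert b A) {a, b} Q := by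
    refine ⟨by rw [← hU1]; exact Finset.subset_union_right, ?_⟩
    intro x hx u hu v hv s _ hs
    obtain ⟨r, hr, rfl⟩ := push_pos _ _ _ _ hs.ne'
    simp only [mem_dup]
    simp only [Finset.mem_sdiff, Finset.mem_insert, Finset.mem_singleton] at hx hu hv
    simp only [Finset.mem_insert]
    grind
  have c1 := hf A {a, b} a hI1 Q (by rw [hU1]; exact hQp) (by rw [hU1]; exact hC)
  have c2 := hf (A.image σ) {a, b} b hI2 Q (by rw [hU2]; exact hQp) (by rw [hU2]; exact hC)
  rw [hU1] at c1
  rw [hU2] at c2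
  have r1 : restrictProfile (insert b A) A Q = R := by
    rw [restrictProfile_eq, hQ, push_push _ _ _ _ _ (fun r hr => dup_mem ha hb hr),
      push_congr _ _ (fun r => r) _ (fun r hr => restrict_dup_self hb hr), push_id _ _ hR.1]
  have r2 : restrictProfile (insert b A) (A.image σ) Q = mapProfile σ A R := by
    rw [restrictProfile_eq, hQ, push_push _ _ _ _ _ (fun r hr => dup_mem ha hb hr),
      push_congr _ _ _ _ (fun r hr => restrict_dup_swap ha hb hr), mapProfile_eq]
  have r3 : f.choice {a, b} (restrictProfile (insert b A) {a, b} Q) =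
      {fun z => if z = a then 1 else 0} := by
    have hP : IsProfile {a, b} (restrictProfile (insert b A) {a, b} Q) :=
      restrictProfile_eq (insert b A) {a, b} Q ▸ push_profile hQp _ (fun r hr => restrict_mem hC.1 hr)
    apply f.unanimity a b _ hP
    unfold pref
    rw [Finset.sum_filter_of_ne, hP.2.2]
    intro s _ hs
    rw [restrictProfile_eq, hQ, push_push _ _ _ _ _ (fun r hr => dup_mem ha hb hr)] at hs
    obtain ⟨r, hr, rfl⟩ := push_pos _ _ _ _ hs
    rw [mem_linOrders] at hr
    have := hr.2.1 a ha
    simp [restrictOrder, mem_dup, ha, hab, this]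
  rw [r1, r3] at c1
  rw [r2, r3] at c2
  rw [c1] at c2
  have hR' : IsProfile (A.image σ) (mapProfile σ A R) :=
    mapProfile_eq σ A R ▸ push_profile hR _ (fun r hr => mapOrder_mem σ hr)
  have l1 : ∀ p ∈ f.choice A R, compLottery {a, b} a p (fun z => if z = a then 1 else 0) = p := by
    intro p hp
    have h := (f.subset_lotteries A hAn R hR hp).1 b hb
    funext x
    unfold compLottery
    simp only [Finset.mem_insert, Finset.mem_singleton]
    grind
  have l2 : ∀ p ∈ f.choice (A.image σ) (mapProfile σ A R),
      compLottery {a, b} b p (fun z => if z = a then 1 else 0) = fun x => p (σ x) := by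
    intro p hp
    have h := (f.subset_lotteries _ (hAn.image _) _ hR' hp).1 a
      (by rw [mem_image_perm]; simpa [hσ] using hb)
    funext x
    unfold compLottery
    simp only [Finset.mem_insert, Finset.mem_singleton, hσ, Equiv.swap_apply_def]
    grind
  have l3 : ∀ p ∈ f.choice A R, mapLottery σ A p = fun x => p (σ x) := by
    intro p hp
    have h := (f.subset_lotteries A hAn R hR hp).1
    funext x
    unfold mapLottery
    have : ∀ y, σ y = x ↔ y = σ x := by
      intro y
      constructor
      · rintro rfl; simp [hσ]
      · rintro rfl; simp [hσ]
    simp only [this]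
    rw [Finset.filter_eq']
    split_ifs with hs
    · simp
    · simp [h _ hs]
  have hσσ : ∀ x, σ (σ x) = x := by intro x; simp [hσ]
  ext q
  constructor
  · intro hq
    have : (fun x => q (σ x)) ∈ compSet {a, b} b (f.choice (A.image σ) (mapProfile σ A R))
      {fun z => if z = a then 1 else 0} := ⟨q, hq, _, rfl, (l2 q hq).symm⟩
    rw [← c2] at this
    obtain ⟨p, hp, _, rfl, e⟩ := this
    rw [l1 p hp] at e
    refine ⟨p, hp, ?_⟩
    rw [l3 p hp, ← e]
    simp only [hσσ]
  · rintro ⟨p, hp, rfl⟩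
    have : p ∈ compSet {a, b} a (f.choice A R)
      {fun z => if z = a then 1 else 0} := ⟨p, hp, _, rfl, (l1 p hp).symm⟩
    rw [c2] at this
    obtain ⟨q, hq, _, rfl, e⟩ := this
    rw [l2 q hq] at e
    rw [l3 p hp, e]
    simpa only [hσσ] using hq

theorem neut_swap {f : PSCF} (hf : CompositionConsistent f) {A : Finset ℕ} (hA : A.Nonempty)
    (a b : ℕ) : Neut f (Equiv.swap a b) A := by
  by_cases hab : a = b
  · subst hab
    exact Neut.congr_one hA (by simp)
  by_cases ha : a ∈ A <;> by_cases hb : b ∈ A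
  · obtain ⟨c, hc⟩ := Infinite.exists_notMem_finset A
    have hca : c ≠ a := fun h => hc (h ▸ ha)
    have hcb : c ≠ b := fun h => hc (h ▸ hb)
    have e : Equiv.swap a b = Equiv.swap c b * (Equiv.swap b a * Equiv.swap a c) := by
      ext x
      simp only [Equiv.Perm.mul_apply, Equiv.swap_apply_def]
      grind
    rw [e]
    refine Neut.mul (Neut.mul (neut_single hf ha hc) (neut_single hf ?_ ?_)) (neut_single hf ?_ ?_)
    · rw [mem_image_perm, Equiv.symm_swap, Equiv.swap_apply_of_ne_of_ne (Ne.symm hab) hcb.symm]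
      exact hb
    · rw [mem_image_perm, Equiv.symm_swap, Equiv.swap_apply_left]; exact hc
    · simp only [mem_image_perm]
      simp only [Equiv.Perm.mul_def, Equiv.symm_trans_apply, Equiv.symm_swap,
        Equiv.swap_apply_def]
      grind
    · simp only [mem_image_perm]
      simp only [Equiv.Perm.mul_def, Equiv.symm_trans_apply, Equiv.symm_swap,
        Equiv.swap_apply_def]
      grind
  · exact neut_single hf ha hb
  · rw [Equiv.swap_comm]; exact neut_single hf hb ha
  · apply Neut.congr_one hA
    intro x hx
    exact Equiv.swap_apply_of_ne_of_ne (fun h => ha (h ▸ hx)) (fun h => hb (h ▸ hx))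

theorem exists_perm {f : PSCF} (hf : CompositionConsistent f) (pi : ℕ → ℕ) (S : Finset ℕ)
    (h : Set.InjOn pi ↑S) :
    ∃ σ : Equiv.Perm ℕ, (∀ x ∈ S, σ x = pi x) ∧ ∀ A : Finset ℕ, A.Nonempty → Neut f σ A := by
  induction S using Finset.induction_on with
  | empty => exact ⟨1, by simp, fun A hA => Neut.congr_one hA (by simp)⟩
  | insert x S hx ih =>
    obtain ⟨τ, h1, h2⟩ := ih (h.mono (by simp))
    refine ⟨Equiv.swap (τ x) (pi x) * τ, ?_, fun A hA =>
      Neut.mul (h2 A hA) (neut_swap hf (hA.image _) _ _)⟩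
    intro y hy
    rw [Equiv.Perm.mul_apply]
    rcases Finset.mem_insert.1 hy with rfl | hy'
    · simp
    · have hne : y ≠ x := fun e => hx (e ▸ hy')
      rw [Equiv.swap_apply_of_ne_of_ne, h1 y hy']
      · exact fun e => hne (τ.injective e)
      · rw [h1 y hy']
        exact fun e => hne (h (by simp [hy']) (by simp) e)

/-- Every composition-consistent PSCF is neutral. -/
theorem compositionConsistent_neutral (f : PSCF) (hf : CompositionConsistent f)
    (A B : Finset ℕ) (hA : A.Nonempty) (hB : B.Nonempty) (pi : ℕ → ℕ)
    (hpi : Set.BijOn pi ↑A ↑B) (R : Finset (ℕ × ℕ) → ℚ) (hR : IsProfile A R) :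
    f.choice B (mapProfile pi A R) = mapLottery pi A '' f.choice A R := by
  obtain ⟨σ, h1, h2⟩ := exists_perm hf pi A hpi.injOn
  have e := h2 A hA R hR
  have e0 : A.image σ = B := by
    rw [Finset.image_congr (g := pi) (fun x hx => h1 x hx)]
    apply Finset.coe_injective
    rw [Finset.coe_image, hpi.image_eq]
  have e1 : mapProfile σ A R = mapProfile pi A R := by
    rw [mapProfile_eq, mapProfile_eq]
    apply push_congr
    intro r hr
    rw [mem_linOrders] at hr
    apply Finset.image_congr
    rintro ⟨x, y⟩ hx
    have := Finset.mem_product.1 (hr.1 hx)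
    simp [h1 x this.1, h1 y this.2]
  have e2 : mapLottery σ A = mapLottery pi A := by
    funext p
    rw [mapLottery_eq, mapLottery_eq]
    exact push_congr _ _ _ _ h1
  rwa [e0, e1, e2] at e

end PSC
end

section
/- The maximal-lotteries correspondence ML satisfies population-consistency: for every agenda A, all profiles R', R'' on A, every rational λ ∈ [0,1], and every lottery p ∈ ML(R') ∩ ML(R''), it holds that p ∈ ML(λR' + (1−λ)R''). -/
open Finset

namespace PSC

/-- `ML` satisfies population-consistency. -/
theorem ml_populationConsistent (A : Finset ℕ) (hA : A.Nonempty)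
    (R' R'' : Finset (ℕ × ℕ) → ℚ) (hR' : IsProfile A R') (hR'' : IsProfile A R'')
    (l : ℚ) (hl0 : 0 ≤ l) (hl1 : l ≤ 1) (p : ℕ → ℚ)
    (hp : p ∈ ML A R' ∩ ML A R'') :
    p ∈ ML A (fun r => l * R' r + (1 - l) * R'' r) := by
  obtain ⟨⟨hp1, h1⟩, ⟨_, h2⟩⟩ := hp
  refine ⟨hp1, fun q hq => ?_⟩
  have hpref : ∀ x y, pref A (fun r => l * R' r + (1 - l) * R'' r) x y
      = l * pref A R' x y + (1 - l) * pref A R'' x y := by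
    intro x y
    simp only [pref, Finset.sum_add_distrib, Finset.mul_sum]
  have key : ∑ x ∈ A, ∑ y ∈ A, p x * margin A (fun r => l * R' r + (1 - l) * R'' r) x y * q y
      = l * (∑ x ∈ A, ∑ y ∈ A, p x * margin A R' x y * q y)
        + (1 - l) * (∑ x ∈ A, ∑ y ∈ A, p x * margin A R'' x y * q y) := by
    simp only [Finset.mul_sum, ← Finset.sum_add_distrib]
    refine Finset.sum_congr rfl fun x _ => Finset.sum_congr rfl fun y _ => ?_
    simp only [margin, hpref]
    ring
  rw [key]
  exact add_nonneg (mul_nonneg hl0 (h1 q hq)) (mul_nonneg (sub_nonneg.2 hl1) (h2 q hq))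

end PSC
end

section
/- The maximal-lotteries correspondence ML satisfies decisiveness: for every agenda A, the set of preference profiles R on A for which ML(R) is a singleton is dense (with respect to the 1-norm) in the set of all profiles on A. -/
open Finset

namespace PSC

theorem farkas_aux {V ι : Type*} [AddCommGroup V] [Module ℚ V] (s : Finset ι) :
    ∀ (α : ι → V →ₗ[ℚ] ℚ) (γ : V →ₗ[ℚ] ℚ),
      (∀ x, (∀ i ∈ s, α i x ≤ 0) → γ x ≤ 0) →
      ∃ l : ι → ℚ, (∀ i, 0 ≤ l i) ∧ ∀ x, γ x = ∑ i ∈ s, l i * α i x := by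
  classical
  induction s using Finset.induction_on with
  | empty =>
    intro α γ h
    refine ⟨fun _ => 0, fun _ => le_rfl, fun x => ?_⟩
    have h1 := h x (by simp)
    have h2 := h (-x) (by simp)
    rw [map_neg] at h2
    simp only [Finset.sum_empty]
    linarith
  | insert a s ha ih =>
    intro α γ h
    by_cases hc : ∀ x, (∀ i ∈ s, α i x ≤ 0) → γ x ≤ 0
    · obtain ⟨l, hl, hx⟩ := ih α γ hc
      refine ⟨fun i => if i = a then 0 else l i, fun i => ?_, fun x => ?_⟩
      · by_cases hi : i = a <;> simp [hi, hl]
      · rw [Finset.sum_insert ha, hx x]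
        simp only [if_true, zero_mul, zero_add]
        refine Finset.sum_congr rfl fun i hi => ?_
        rw [if_neg (fun e : i = a => ha (e ▸ hi))]
    · push Not at hc
      obtain ⟨x0, hx0, hg⟩ := hc
      have hpos : 0 < α a x0 := by
        by_contra hn
        have := h x0 (fun i hi => by
          rcases Finset.mem_insert.1 hi with rfl | hi
          · exact not_lt.1 hn
          · exact hx0 i hi)
        linarith
      set c := α a x0 with hcdef
      obtain ⟨l, hl, hx⟩ := ih (fun i => α i - (α i x0 / c) • α a) (γ - (γ x0 / c) • α a) (by
        intro x hxx
        have key := h (x - (α a x / c) • x0) (by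
          intro i hi
          rcases Finset.mem_insert.1 hi with rfl | hi
          · simp only [map_sub, map_smul, smul_eq_mul, ← hcdef]
            rw [div_mul_cancel₀ _ hpos.ne']; simp
          · have := hxx i hi
            simp only [LinearMap.sub_apply, LinearMap.smul_apply, smul_eq_mul] at this
            simp only [map_sub, map_smul, smul_eq_mul]
            have e : α i x0 / c * α a x = α a x / c * α i x0 := by ring
            linarith)
        simp only [map_sub, map_smul, smul_eq_mul] at key
        simp only [LinearMap.sub_apply, LinearMap.smul_apply, smul_eq_mul]
        have e : γ x0 / c * α a x = α a x / c * γ x0 := by ring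
        linarith)
      have hco : 0 ≤ γ x0 / c - ∑ i ∈ s, l i * (α i x0 / c) := by
        have h1 : 0 < γ x0 / c := div_pos hg hpos
        have h2 : ∑ i ∈ s, l i * (α i x0 / c) ≤ 0 :=
          Finset.sum_nonpos fun i hi => mul_nonpos_of_nonneg_of_nonpos (hl i)
            (div_nonpos_of_nonpos_of_nonneg (hx0 i hi) hpos.le)
        linarith
      refine ⟨fun i => if i = a then γ x0 / c - ∑ i ∈ s, l i * (α i x0 / c) else l i,
        fun i => ?_, fun x => ?_⟩
      · by_cases hi : i = a
        · simpa only [hi, if_true] using hco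
        · simpa only [hi, if_false] using hl i
      · rw [Finset.sum_insert ha]
        simp only [if_true]
        have e1 : ∑ i ∈ s, (if i = a then γ x0 / c - ∑ i ∈ s, l i * (α i x0 / c) else l i) * α i x
            = ∑ i ∈ s, l i * α i x :=
          Finset.sum_congr rfl fun i hi => by rw [if_neg (fun e : i = a => ha (e ▸ hi))]
        rw [e1]
        have := hx x
        simp only [LinearMap.sub_apply, LinearMap.smul_apply, smul_eq_mul, mul_sub,
          Finset.sum_sub_distrib] at this
        rw [sub_mul, Finset.sum_mul]
        have e2 : ∑ i ∈ s, l i * (α i x0 / c) * α a x = ∑ i ∈ s, l i * (α i x0 / c * α a x) :=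
          Finset.sum_congr rfl fun i _ => by ring
        rw [e2]
        linarith

theorem exists_opt {ι : Type*} [Fintype ι] [Nonempty ι] (M : ι → ι → ℚ)
    (hM : ∀ x y, M y x = - M x y) :
    ∃ p : ι → ℚ, (∀ x, 0 ≤ p x) ∧ ∑ x, p x = 1 ∧ ∀ y, 0 ≤ ∑ x, p x * M x y := by
  classical
  have main : ∃ p : ι → ℚ, (∀ x, 0 ≤ p x) ∧ 0 < ∑ x, p x ∧ ∀ y, 0 ≤ ∑ x, p x * M x y := by
    by_contra hno
    push Not at hno
    let ev : ι → (ι → ℚ) →ₗ[ℚ] ℚ := fun x => LinearMap.proj x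
    have hev : ∀ x p, ev x p = p x := fun _ _ => rfl
    let α : ι ⊕ ι → (ι → ℚ) →ₗ[ℚ] ℚ := fun i => Sum.elim (fun x => - ev x)
      (fun y => - ∑ x, M x y • ev x) i
    have hα2 : ∀ y p, α (Sum.inr y) p = - ∑ x, p x * M x y := by
      intro y p
      simp [α, hev, LinearMap.sum_apply, mul_comm]
    have hα1 : ∀ y p, α (Sum.inl y) p = - p y := by
      intro y p
      simp [α, hev]
    have hγ : ∀ p, (∑ x, ev x) p = ∑ x, p x := by
      intro p; simp [hev, LinearMap.sum_apply]
    have feas : ∀ p : ι → ℚ, (∀ x, 0 ≤ p x) → (∀ y, 0 ≤ ∑ x, p x * M x y) → ∑ x, p x ≤ 0 := by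
      intro p h1 h2
      by_contra h3
      obtain ⟨y, hy⟩ := hno p h1 (not_le.1 h3)
      exact absurd (h2 y) (not_le.2 hy)
    obtain ⟨l, hl, hx⟩ := farkas_aux Finset.univ α (∑ x, ev x) (by
      intro p hp
      rw [hγ]
      refine feas p (fun x => ?_) (fun y => ?_)
      · have := hp (Sum.inl x) (Finset.mem_univ _); rw [hα1] at this; linarith
      · have := hp (Sum.inr y) (Finset.mem_univ _); rw [hα2] at this; linarith)
    have hmu : ∀ z, ∑ y, l (Sum.inr y) * M y z = 1 + l (Sum.inl z) := by
      intro z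
      have := hx (Pi.single z 1)
      rw [hγ, Fintype.sum_sum_type] at this
      simp only [hα1, hα2, Pi.single_apply, ite_mul, one_mul, zero_mul, Finset.sum_ite_eq',
        Finset.sum_ite_eq, Finset.mem_univ, if_true, mul_neg, mul_ite, mul_one, mul_zero,
        Finset.sum_neg_distrib] at this
      have e : ∑ y, l (Sum.inr y) * M y z = - ∑ y, l (Sum.inr y) * M z y := by
        rw [← Finset.sum_neg_distrib]
        exact Finset.sum_congr rfl fun y _ => by rw [hM z y]; ring
      rw [e]; linarith
    have h0 := feas (fun y => l (Sum.inr y)) (fun y => hl _) (fun z => by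
      rw [hmu]; have := hl (Sum.inl z); linarith)
    have h1 : ∀ y, l (Sum.inr y) = 0 := by
      have := (Finset.sum_eq_zero_iff_of_nonneg (s := Finset.univ)
        (f := fun y => l (Sum.inr y)) (fun y _ => hl _)).1
          (le_antisymm h0 (Finset.sum_nonneg fun y _ => hl _))
      exact fun y => this y (Finset.mem_univ _)
    obtain ⟨z⟩ := ‹Nonempty ι›
    have := hmu z
    simp only [h1, zero_mul, Finset.sum_const_zero] at this
    have := hl (Sum.inl z)
    linarith
  obtain ⟨p, h1, h2, h3⟩ := main
  refine ⟨fun x => p x / ∑ x, p x, fun x => div_nonneg (h1 x) h2.le, ?_, fun y => ?_⟩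
  · rw [← Finset.sum_div, div_self h2.ne']
  · have : ∑ x, p x / (∑ x, p x) * M x y = (∑ x, p x * M x y) / ∑ x, p x := by
      rw [Finset.sum_div]; exact Finset.sum_congr rfl fun x _ => by ring
    rw [this]; exact div_nonneg (h3 y) h2.le

/-- 2-adic uniqueness of kernel vectors. -/
theorem kernel_zero (S : Finset ℕ) (M : ℕ → ℕ → ℚ) (K : ℚ)
    (hd : ∀ x, M x x = 0)
    (hodd : ∀ x ∈ S, ∀ y ∈ S, x ≠ y → ∃ m : ℤ, K * M x y = 2 * m + 1)
    (d : ℕ → ℚ) (hs : ∑ x ∈ S, d x = 0) (hk : ∀ y ∈ S, ∑ x ∈ S, d x * M x y = 0) :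
    ∀ x ∈ S, d x = 0 := by
  classical
  by_contra hne
  push Not at hne
  obtain ⟨w, hw, hdw⟩ := hne
  obtain ⟨y, hy, hmax⟩ := Finset.exists_max_image S (fun x => padicNorm 2 (d x)) ⟨w, hw⟩
  have hpos : 0 < padicNorm 2 (d y) := by
    refine lt_of_lt_of_le ?_ (hmax w hw)
    exact lt_of_le_of_ne (padicNorm.nonneg _) (Ne.symm (padicNorm.nonzero hdw))
  have e : d y = ∑ x ∈ S.erase y, d x * (K * M x y - 1) := by
    have h1 := Finset.add_sum_erase S d hy
    have h2 := Finset.add_sum_erase S (fun x => d x * M x y) hy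
    rw [hk y hy] at h2
    rw [hs] at h1
    simp only [hd, mul_zero, zero_add] at h2
    have : ∑ x ∈ S.erase y, d x * (K * M x y - 1) =
        K * (∑ x ∈ S.erase y, d x * M x y) - ∑ x ∈ S.erase y, d x := by
      rw [Finset.mul_sum, ← Finset.sum_sub_distrib]
      exact Finset.sum_congr rfl fun x _ => by ring
    rw [this, h2]; linarith
  have hle : padicNorm 2 (d y) ≤ padicNorm 2 (d y) * (1 / 2) := by
    conv_lhs => rw [e]
    refine padicNorm.sum_le' (fun x hx => ?_) (by positivity)
    obtain ⟨hxy, hxS⟩ := Finset.mem_erase.1 hx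
    obtain ⟨m, hm⟩ := hodd x hxS y hy hxy
    rw [hm, padicNorm.mul]
    have : padicNorm 2 (2 * (m : ℚ) + 1 - 1) ≤ 1 / 2 := by
      rw [add_sub_cancel_right, padicNorm.mul]
      have h2 : padicNorm 2 (2 : ℚ) = 1 / 2 := by
        have := padicNorm.padicNorm_p_of_prime (p := 2)
        simpa using this
      rw [h2]
      have := padicNorm.of_int (p := 2) m
      linarith
    exact mul_le_mul (hmax x hxS) this (padicNorm.nonneg _) (padicNorm.nonneg _)
  linarith

theorem opt_unique (A : Finset ℕ) (M : ℕ → ℕ → ℚ) (K : ℚ)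
    (hM : ∀ x y, M y x = - M x y)
    (hodd : ∀ x ∈ A, ∀ y ∈ A, x ≠ y → ∃ m : ℤ, K * M x y = 2 * m + 1)
    (p q : ℕ → ℚ) (hp : IsLottery A p) (hq : IsLottery A q)
    (hpM : ∀ y ∈ A, 0 ≤ ∑ x ∈ A, p x * M x y) (hqM : ∀ y ∈ A, 0 ≤ ∑ x ∈ A, q x * M x y) :
    p = q := by
  classical
  have hd : ∀ x, M x x = 0 := fun x => by have := hM x x; linarith
  have bil : ∀ a b : ℕ → ℚ, ∑ y ∈ A, (∑ x ∈ A, a x * M x y) * b y =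
      - ∑ y ∈ A, (∑ x ∈ A, b x * M x y) * a y := by
    intro a b
    simp only [Finset.sum_mul]
    rw [Finset.sum_comm, ← Finset.sum_neg_distrib]
    refine Finset.sum_congr rfl fun y _ => ?_
    rw [← Finset.sum_neg_distrib]
    exact Finset.sum_congr rfl fun x _ => by rw [hM x y]; ring
  -- complementary slackness
  have slack : ∀ a b : ℕ → ℚ, (∀ x, 0 ≤ a x) → (∀ x, 0 ≤ b x) →
      (∀ y ∈ A, 0 ≤ ∑ x ∈ A, a x * M x y) → (∀ y ∈ A, 0 ≤ ∑ x ∈ A, b x * M x y) →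
      ∀ y ∈ A, b y ≠ 0 → ∑ x ∈ A, a x * M x y = 0 := by
    intro a b ha hb haM hbM y hy hby
    have n1 : ∀ y ∈ A, 0 ≤ (∑ x ∈ A, a x * M x y) * b y :=
      fun y hy => mul_nonneg (haM y hy) (hb y)
    have n2 : 0 ≤ ∑ y ∈ A, (∑ x ∈ A, b x * M x y) * a y :=
      Finset.sum_nonneg fun y hy => mul_nonneg (hbM y hy) (ha y)
    have n3 := Finset.sum_nonneg n1
    have z : ∑ y ∈ A, (∑ x ∈ A, a x * M x y) * b y = 0 := by
      have := bil a b; linarith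
    have := (Finset.sum_eq_zero_iff_of_nonneg n1).1 z y hy
    exact (mul_eq_zero.1 this).resolve_right hby
  set S := A.filter (fun x => p x ≠ 0 ∨ q x ≠ 0) with hS
  have hSA : S ⊆ A := Finset.filter_subset _ _
  have hout : ∀ x ∈ A, x ∉ S → p x = 0 ∧ q x = 0 := by
    intro x hx hn
    by_contra hc
    exact hn (Finset.mem_filter.2 ⟨hx, by tauto⟩)
  have hker : ∀ x ∈ S, p x - q x = 0 := by
    refine kernel_zero S M K hd (fun x hx y hy => hodd x (hSA hx) y (hSA hy))
      (fun x => p x - q x) ?_ ?_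
    · rw [Finset.sum_subset hSA (fun x hx hn => by rw [(hout x hx hn).1, (hout x hx hn).2, sub_zero]),
        Finset.sum_sub_distrib, hp.2.2, hq.2.2, sub_self]
    · intro y hy
      rw [Finset.sum_subset hSA (fun x hx hn => by
        rw [(hout x hx hn).1, (hout x hx hn).2, sub_zero, zero_mul])]
      obtain ⟨hyA, hyor⟩ := Finset.mem_filter.1 hy
      simp only [sub_mul, Finset.sum_sub_distrib]
      rcases hyor with h | h
      · rw [slack p p hp.2.1 hp.2.1 hpM hpM y hyA h, slack q p hq.2.1 hp.2.1 hqM hpM y hyA h,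
          sub_self]
      · rw [slack p q hp.2.1 hq.2.1 hpM hqM y hyA h, slack q q hq.2.1 hq.2.1 hqM hqM y hyA h,
          sub_self]
  funext x
  by_cases hx : x ∈ A
  · by_cases hxS : x ∈ S
    · have := hker x hxS; linarith
    · rw [(hout x hx hxS).1, (hout x hx hxS).2]
  · rw [hp.1 x hx, hq.1 x hx]

theorem mem_ML_iff (A : Finset ℕ) (R : Finset (ℕ × ℕ) → ℚ) (p : ℕ → ℚ) :
    p ∈ ML A R ↔ IsLottery A p ∧ ∀ y ∈ A, 0 ≤ ∑ x ∈ A, p x * margin A R x y := by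
  classical
  constructor
  · rintro ⟨h1, h2⟩
    refine ⟨h1, fun y hy => ?_⟩
    have := h2 (fun z => if z = y then 1 else 0) ⟨fun x hx => ?_, fun x => ?_, ?_⟩
    · simpa [hy] using this
    · simp only; rw [if_neg]; rintro rfl; exact hx hy
    · simp only; split_ifs <;> norm_num
    · simp [hy]
  · rintro ⟨h1, h2⟩
    refine ⟨h1, fun q hq => ?_⟩
    rw [Finset.sum_comm]
    refine Finset.sum_nonneg fun y hy => ?_
    rw [← Finset.sum_mul]
    exact mul_nonneg (h2 y hy) (hq.2.1 y)

theorem ML_singleton (A : Finset ℕ) (hA : A.Nonempty) (R : Finset (ℕ × ℕ) → ℚ) (K : ℚ)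
    (hodd : ∀ x ∈ A, ∀ y ∈ A, x ≠ y → ∃ m : ℤ, K * margin A R x y = 2 * m + 1) :
    ∃ p, ML A R = {p} := by
  classical
  have hM : ∀ x y, margin A R y x = - margin A R x y := fun x y => by
    unfold margin; ring
  have : Nonempty A := hA.to_subtype
  obtain ⟨p, h1, h2, h3⟩ := exists_opt (ι := A) (fun x y => margin A R x y)
    (fun x y => hM x y)
  let P : ℕ → ℚ := fun x => if h : x ∈ A then p ⟨x, h⟩ else 0
  have hP : ∀ x : A, P x = p x := fun x => by simp [P]
  have hPM : P ∈ ML A R := by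
    rw [mem_ML_iff]
    refine ⟨⟨fun x hx => by simp [P, hx], fun x => ?_, ?_⟩, fun y hy => ?_⟩
    · simp only [P]; split_ifs
      · exact h1 _
      · exact le_rfl
    · rw [← Finset.sum_coe_sort]; simpa only [hP] using h2
    · rw [← Finset.sum_coe_sort A (fun x => P x * margin A R x y)]
      simpa only [hP] using h3 ⟨y, hy⟩
  refine ⟨P, Set.eq_singleton_iff_unique_mem.2 ⟨hPM, fun q hq => ?_⟩⟩
  rw [mem_ML_iff] at hPM hq
  exact opt_unique A _ K hM hodd q P hq.1 hPM.1 hq.2 hPM.2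

theorem pref_add (A : Finset ℕ) (R : Finset (ℕ × ℕ) → ℚ) (hR : IsProfile A R) (x y : ℕ)
    (hx : x ∈ A) (hy : y ∈ A) (hxy : x ≠ y) : pref A R x y + pref A R y x = 1 := by
  classical
  rw [← hR.2.2]
  unfold pref
  rw [← Finset.sum_filter_add_sum_filter_not (linOrders A) (fun r => (x, y) ∈ r ∧ (y, x) ∉ r) R]
  congr 1
  · refine Finset.sum_congr (Finset.filter_congr fun r hr => ?_) fun _ _ => rfl
    obtain ⟨-, -, -, htot, -, hanti⟩ := Finset.mem_filter.1 hr
    have h1 := htot x hx y hy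
    have h2 := hanti x y
    tauto

theorem dense_aux (A : Finset ℕ) (R : Finset (ℕ × ℕ) → ℚ)
    (hR : IsProfile A R) (eps : ℚ) (heps : 0 < eps) :
    ∃ R', IsProfile A R' ∧ profileDist A R R' < eps ∧
      ∃ j : ℕ, ∀ r ∈ linOrders A, ∃ k : ℤ, ((2 * j + 1 : ℕ) : ℚ) * R' r = k := by
  classical
  have hne : (linOrders A).Nonempty := by
    rw [Finset.nonempty_iff_ne_empty]
    intro h
    have := hR.2.2
    rw [h] at this; simp at this
  obtain ⟨r0, hr0⟩ := hne
  set D : ℕ := ∏ r ∈ linOrders A, (R r).den with hD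
  have hDpos : 0 < D := Finset.prod_pos fun r _ => (R r).den_pos
  have hint : ∀ r ∈ linOrders A, ∃ k : ℤ, (D : ℚ) * R r = k := by
    intro r hr
    obtain ⟨c, hc⟩ := Finset.dvd_prod_of_mem (fun r => (R r).den) hr
    refine ⟨c * (R r).num, ?_⟩
    rw [hD, hc]
    push_cast
    rw [mul_comm ((R r).den : ℚ), mul_assoc, Rat.den_mul_eq_num]
  obtain ⟨n, hn⟩ := exists_nat_gt (2 / eps)
  have hKpos : (0 : ℚ) < ((2 * (n * D) + 1 : ℕ) : ℚ) := by positivity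
  set K : ℚ := ((2 * (n * D) + 1 : ℕ) : ℚ) with hK
  have hKe : K = 2 * (n * D) + 1 := by rw [hK]; push_cast; ring
  set dl : Finset (ℕ × ℕ) → ℚ := fun r => if r = r0 then 1 else 0 with hdl
  have hdl0 : ∀ r, 0 ≤ dl r := fun r => by simp only [hdl]; split_ifs <;> norm_num
  have hdls : ∑ r ∈ linOrders A, dl r = 1 := by simp [hdl, hr0]
  refine ⟨fun r => (2 * (n * D) * R r + dl r) / K, ⟨fun r hr => ?_, fun r => ?_, ?_⟩, ?_,
    n * D, fun r hr => ?_⟩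
  · have : dl r = 0 := by simp only [hdl]; rw [if_neg]; rintro rfl; exact hr hr0
    simp only [hR.1 r hr, this]; simp
  · have := hR.2.1 r
    have := hdl0 r
    positivity
  · rw [← Finset.sum_div, Finset.sum_add_distrib, ← Finset.mul_sum, hR.2.2, hdls, mul_one, ← hKe,
      div_self hKpos.ne']
  · unfold profileDist
    have : ∀ r ∈ linOrders A, |R r - (2 * (n * D) * R r + dl r) / K| ≤ (R r + dl r) / K := by
      intro r _
      have e : R r - (2 * (n * D) * R r + dl r) / K = (R r - dl r) / K := by
        field_simp
        rw [hKe]; ring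
      rw [e, abs_div, abs_of_pos hKpos]
      have := hR.2.1 r
      have := hdl0 r
      gcongr
      rw [abs_le]; constructor <;> linarith
    refine lt_of_le_of_lt (Finset.sum_le_sum this) ?_
    rw [← Finset.sum_div, Finset.sum_add_distrib, hR.2.2, hdls, div_lt_iff₀ hKpos]
    rw [div_lt_iff₀ heps] at hn
    have hD1 : (1 : ℚ) ≤ D := by exact_mod_cast hDpos
    have hn0 : (0 : ℚ) ≤ n := by positivity
    have : (n : ℚ) ≤ K := by rw [hKe]; nlinarith
    nlinarith
  · obtain ⟨k, hk⟩ := hint r hr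
    refine ⟨2 * n * k + (if r = r0 then 1 else 0), ?_⟩
    rw [← hK]
    rw [mul_div_cancel₀ _ hKpos.ne']
    push_cast
    rw [← hk]
    simp only [hdl]; ring

/-- `ML` satisfies decisiveness: the profiles with a unique maximal lottery are dense. -/
theorem ml_decisive (A : Finset ℕ) (hA : A.Nonempty) (R : Finset (ℕ × ℕ) → ℚ)
    (hR : IsProfile A R) (eps : ℚ) (heps : 0 < eps) :
    ∃ R', IsProfile A R' ∧ profileDist A R R' < eps ∧ ∃ p, ML A R' = {p} := by
  classical
  obtain ⟨R', hR', hdist, j, hj⟩ := dense_aux A R hR eps heps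
  refine ⟨R', hR', hdist, ML_singleton A hA R' ((2 * j + 1 : ℕ) : ℚ) fun x hx y hy hxy => ?_⟩
  have hsum := pref_add A R' hR' x y hx hy hxy
  have hP : ∃ k : ℤ, ((2 * j + 1 : ℕ) : ℚ) * pref A R' x y = k := by
    choose! f hf using hj
    unfold pref
    rw [Finset.mul_sum, Finset.sum_congr rfl fun r hr => hf r (Finset.mem_filter.1 hr).1]
    exact ⟨∑ r ∈ _, f r, by push_cast; rfl⟩
  obtain ⟨k, hk⟩ := hP
  refine ⟨k - j - 1, ?_⟩
  unfold margin
  have e : pref A R' y x = 1 - pref A R' x y := by linarith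
  rw [e]
  push_cast at hk ⊢
  linear_combination 2 * hk

end PSC
end

section
/- Fix natural numbers 2 ≤ n' ≤ n. Let M_{n'} be the ℚ-vector space of skew-symmetric matrices M ∈ ℚ^{n×n} with all row sums 0 and M(i,j) = 0 whenever {i,j} ⊄ [n'], and let M°_{n'} be the set of matrices in M_{n'} induced by cyclic permutations: M ∈ M°_{n'} iff there exist B ⊆ [n'] with |B| ≥ 3 and a permutation π of [n] that is cyclic on B and the identity outside B, such that M(i,j) = 1 if j = π(i) and i ∈ B, M(i,j) = −1 if i = π(j) and j ∈ B, and M(i,j) = 0 otherwise (with the convention M°_2 = {0}). Then the ℚ-linear hull of M°_{n'} equals M_{n'}. -/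
open Finset

namespace PSC

/-- Matrix of the directed triangle `z → i → j → z`. -/
def triMat {n : ℕ} (z i j : Fin n) : Matrix (Fin n) (Fin n) ℚ := fun a b =>
  ((if a = z then 1 else 0) * (if b = i then 1 else 0)
    - (if a = i then 1 else 0) * (if b = z then 1 else 0))
  + ((if a = i then 1 else 0) * (if b = j then 1 else 0)
    - (if a = j then 1 else 0) * (if b = i then 1 else 0))
  + ((if a = j then 1 else 0) * (if b = z then 1 else 0)
    - (if a = z then 1 else 0) * (if b = j then 1 else 0))

theorem cyc_no_two {n : ℕ} (B : Finset (Fin n)) (pi : Equiv.Perm (Fin n))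
    (hc : 3 ≤ B.card) (h : pi.IsCycleOn ↑B) (i j : Fin n) (hi : i ∈ B)
    (h1 : j = pi i) (h2 : i = pi j) : False := by
  have h3 : (pi ^ 2) i = i := by
    rw [pow_two, Equiv.Perm.mul_apply, ← h1, ← h2]
  have h4 := (h.pow_apply_eq hi).1 h3
  have := Nat.le_of_dvd (by norm_num) h4
  omega

theorem tri_isCycleOn {n : ℕ} (z i j : Fin n) (h1 : z ≠ i) (h2 : z ≠ j) (h3 : i ≠ j) :
    (Equiv.swap z i * Equiv.swap i j).IsCycleOn ↑({z, i, j} : Finset (Fin n)) := by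
  have hc : (Equiv.swap i z * Equiv.swap i j).IsThreeCycle :=
    Equiv.Perm.isThreeCycle_swap_mul_swap_same h1.symm h3 h2
  rw [Equiv.swap_comm i z] at hc
  have := hc.isCycle.isCycleOn
  convert this using 1
  ext x
  simp only [Finset.coe_insert, Finset.coe_singleton, Set.mem_insert_iff,
    Set.mem_singleton_iff, Set.mem_ofPred_eq, Equiv.Perm.mul_apply, Equiv.swap_apply_def]
  grind

/-- The linear hull of the cyclic-permutation matrices `M°_{n'}` is all of `M_{n'}`. -/
theorem span_cyclic_matrices (n n' : ℕ) (h2 : 2 ≤ n') (hn : n' ≤ n) :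
    (Submodule.span ℚ
      (insert (0 : Matrix (Fin n) (Fin n) ℚ)
        {M : Matrix (Fin n) (Fin n) ℚ |
          ∃ B : Finset (Fin n), ∃ pi : Equiv.Perm (Fin n),
            (∀ i ∈ B, (i : ℕ) < n') ∧ 3 ≤ B.card ∧ (∀ i ∉ B, pi i = i) ∧
            pi.IsCycleOn ↑B ∧
            M = Matrix.of fun i j =>
              if j = pi i ∧ i ∈ B then (1 : ℚ)
              else if i = pi j ∧ j ∈ B then -1 else 0}) :
      Set (Matrix (Fin n) (Fin n) ℚ)) =
    {M : Matrix (Fin n) (Fin n) ℚ |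
      (∀ i j, M i j = - M j i) ∧ (∀ i, (∑ j, M i j) = 0) ∧
      ∀ i j : Fin n, ¬((i : ℕ) < n' ∧ (j : ℕ) < n') → M i j = 0} := by
  have hn0 : 0 < n := by omega
  apply Set.Subset.antisymm
  · let S : Submodule ℚ (Matrix (Fin n) (Fin n) ℚ) :=
      { carrier := {M : Matrix (Fin n) (Fin n) ℚ |
          (∀ i j, M i j = - M j i) ∧ (∀ i, (∑ j, M i j) = 0) ∧
          ∀ i j : Fin n, ¬((i : ℕ) < n' ∧ (j : ℕ) < n') → M i j = 0}
        zero_mem' := by simp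
        add_mem' := by
          rintro a b ⟨a1, a2, a3⟩ ⟨b1, b2, b3⟩
          refine ⟨fun i j => ?_, fun i => ?_, fun i j h => ?_⟩
          · simp only [Matrix.add_apply]
            rw [a1 i j, b1 i j]; ring
          · simp [Matrix.add_apply, Finset.sum_add_distrib, a2, b2]
          · simp [Matrix.add_apply, a3 i j h, b3 i j h]
        smul_mem' := by
          rintro c a ⟨a1, a2, a3⟩
          refine ⟨fun i j => ?_, fun i => ?_, fun i j h => ?_⟩
          · simp only [Matrix.smul_apply, smul_eq_mul]
            rw [a1 i j]; ring
          · simp [Matrix.smul_apply, ← Finset.mul_sum, a2]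
          · simp [Matrix.smul_apply, a3 i j h] }
    change Submodule.span ℚ _ ≤ S
    rw [Submodule.span_le]
    rintro M (rfl | ⟨B, pi, hB, hc, hfix, hcyc, rfl⟩)
    · exact S.zero_mem
    have hmem : ∀ i, pi i ∈ B ↔ i ∈ B := fun i => by
      simpa using hcyc.apply_mem_iff (x := i)
    have hno := cyc_no_two B pi hc hcyc
    refine ⟨fun i j => ?_, fun i => ?_, fun i j h => ?_⟩
    · simp only [Matrix.of_apply]
      by_cases c1 : j = pi i ∧ i ∈ B <;> by_cases c2 : i = pi j ∧ j ∈ B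
      · exact (hno i j c1.2 c1.1 c2.1).elim
      · rw [if_pos c1, if_neg c2, if_pos c1]; norm_num
      · rw [if_neg c1, if_pos c2, if_pos c2]
      · rw [if_neg c1, if_neg c2, if_neg c2, if_neg c1]; norm_num
    · have e : ∀ j, (Matrix.of fun i j : Fin n =>
              if j = pi i ∧ i ∈ B then (1 : ℚ)
              else if i = pi j ∧ j ∈ B then -1 else 0) i j =
          (if j = pi i then (if i ∈ B then (1:ℚ) else 0) else 0)
            - (if j = pi.symm i then (if i ∈ B then (1:ℚ) else 0) else 0) := by
        intro j
        simp only [Matrix.of_apply]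
        have e1 : i = pi j ↔ j = pi.symm i := by
          rw [Equiv.eq_symm_apply]; exact eq_comm
        have := hno i j
        have := hmem j
        grind
      rw [Finset.sum_congr rfl (fun j _ => e j), Finset.sum_sub_distrib]
      simp
    · simp only [Matrix.of_apply]
      have := hmem i
      have := hmem j
      have := hB i
      have := hB j
      grind
  · rintro M ⟨m1, m2, m3⟩
    let z : Fin n := ⟨0, hn0⟩
    have hz : (z : ℕ) < n' := by change 0 < n'; omega
    have m2' : ∀ j, ∑ i, M i j = 0 := fun j => by
      rw [Finset.sum_congr rfl (fun i _ => m1 i j), Finset.sum_neg_distrib, m2, neg_zero]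
    have key : M = ∑ i, ∑ j, (M i j / 2) • triMat z i j := by
      ext a b
      simp only [Matrix.sum_apply, Matrix.smul_apply, smul_eq_mul, triMat]
      have c1 : ∀ x y : ℚ, ∑ i, ∑ j, M i j * (if b = i then x else 0) * y = 0 := by
        intro x y
        simp_rw [mul_assoc, ← Finset.sum_mul, m2]; simp
      have c2 : ∀ x y : ℚ, ∑ i, ∑ j, M i j * (if a = i then x else 0) * y = 0 := by
        intro x y
        simp_rw [mul_assoc, ← Finset.sum_mul, m2]; simp
      have c3 : ∀ x y : ℚ, ∑ i, ∑ j, M i j * (if b = j then x else 0) * y = 0 := by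
        intro x y
        rw [Finset.sum_comm]
        simp_rw [mul_assoc, ← Finset.sum_mul, m2']; simp
      have c4 : ∀ x y : ℚ, ∑ i, ∑ j, M i j * (if a = j then x else 0) * y = 0 := by
        intro x y
        rw [Finset.sum_comm]
        simp_rw [mul_assoc, ← Finset.sum_mul, m2']; simp
      have c5 : ∑ i, ∑ j, M i j * ((if a = i then 1 else 0) * (if b = j then 1 else 0)) = M a b := by
        simp
      have c6 : ∑ i, ∑ j, M i j * ((if a = j then 1 else 0) * (if b = i then 1 else 0)) = M b a := by
        simp
      have e : ∀ i j, M i j / 2 * (((if a = z then 1 else 0) * (if b = i then 1 else 0)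
            - (if a = i then 1 else 0) * (if b = z then 1 else 0))
          + ((if a = i then 1 else 0) * (if b = j then 1 else 0)
            - (if a = j then 1 else 0) * (if b = i then 1 else 0))
          + ((if a = j then 1 else 0) * (if b = z then 1 else 0)
            - (if a = z then 1 else 0) * (if b = j then 1 else 0))) =
          M i j * (if b = i then 1 else 0) * ((if a = z then 1 else 0) / 2)
          - M i j * (if a = i then 1 else 0) * ((if b = z then 1 else 0) / 2)
          + M i j * ((if a = i then 1 else 0) * (if b = j then 1 else 0)) * (1 / 2)
          - M i j * ((if a = j then 1 else 0) * (if b = i then 1 else 0)) * (1 / 2)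
          + M i j * (if a = j then 1 else 0) * ((if b = z then 1 else 0) / 2)
          - M i j * (if b = j then 1 else 0) * ((if a = z then 1 else 0) / 2) := by
        intro i j; ring
      simp_rw [e]
      simp only [Finset.sum_add_distrib, Finset.sum_sub_distrib, c1, c2, c3, c4]
      simp only [← Finset.sum_mul, c5, c6]
      rw [m1 b a]; ring
    rw [key]
    refine Submodule.sum_mem _ fun i _ => Submodule.sum_mem _ fun j _ => ?_
    by_cases hij : (i : ℕ) < n' ∧ (j : ℕ) < n'
    swap
    · rw [m3 i j hij]; simp
    refine Submodule.smul_mem _ _ (Submodule.subset_span ?_)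
    by_cases h1 : z = i
    · left; ext a b; subst h1; simp only [triMat, Matrix.zero_apply]; ring
    by_cases h2 : z = j
    · left; ext a b; subst h2; simp only [triMat, Matrix.zero_apply]; ring
    by_cases h3 : i = j
    · left; ext a b; subst h3; simp only [triMat, Matrix.zero_apply]; ring
    right
    refine ⟨{z, i, j}, Equiv.swap z i * Equiv.swap i j, ?_, ?_, ?_,
      tri_isCycleOn z i j h1 h2 h3, ?_⟩
    · intro x hx
      simp only [Finset.mem_insert, Finset.mem_singleton] at hx
      rcases hx with rfl | rfl | rfl
      · exact hz
      · exact hij.1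
      · exact hij.2
    · rw [Finset.card_eq_three.2 ⟨z, i, j, h1, h2, h3, rfl⟩]
    · intro x hx
      simp only [Finset.mem_insert, Finset.mem_singleton, not_or] at hx
      simp [Equiv.swap_apply_of_ne_of_ne, hx]
    · have p1 : (Equiv.swap z i * Equiv.swap i j) z = i := by
        simp [Equiv.swap_apply_of_ne_of_ne h1 h2]
      have p2 : (Equiv.swap z i * Equiv.swap i j) i = j := by
        simp [Equiv.swap_apply_of_ne_of_ne (Ne.symm h2) (Ne.symm h3)]
      have p3 : (Equiv.swap z i * Equiv.swap i j) j = z := by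
        simp
      generalize (Equiv.swap z i * Equiv.swap i j) = q at p1 p2 p3
      ext a b
      simp only [triMat, Matrix.of_apply, Finset.mem_insert, Finset.mem_singleton]
      clear key
      by_cases a1 : a = z
      · subst a1; grind
      by_cases a2 : a = i
      · subst a2; grind
      by_cases a3 : a = j
      · subst a3; grind
      grind

end PSC
end
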